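/- arXiv:1609.07924 — 3 statements merged into one kernel-verified Lean document; each statement's English description precedes it below -/
import Mathlib

section
/- In the free group F = FreeGroup (Fin 4) on four generators, the subgroup L₁ = Subgroup.closure {x₁, x₂, x₃} is malnormal in F: for every g ∈ F with g ∉ L₁, the intersection L₁ ∩ g⁻¹L₁g is the trivial subgroup. -/
/-- The conjugate subgroup `g⁻¹ H g = {g⁻¹ h g : h ∈ H}`. -/
def conjSub {G : Type*} [Group G] (g : G) (H : Subgroup G) : Subgroup G :=
  H.map (MulAut.conj g⁻¹).toMonoidHom

namespace FreeGroup

variable {α : Type*} {S : Set α}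

theorem mk_singleton_mem_closure_image_of {a : α × Bool} (ha : a.1 ∈ S) :
    mk [a] ∈ Subgroup.closure (of '' S) := by
  have hof : of a.1 ∈ Subgroup.closure (of '' S) := Subgroup.subset_closure ⟨a.1, ha, rfl⟩
  obtain ⟨x, b⟩ := a
  cases b
  · simpa [of, invRev] using inv_mem hof
  · exact hof

theorem fst_mem_of_mem_toWord_of_mem_closure [DecidableEq α] {h : FreeGroup α}
    (hh : h ∈ Subgroup.closure (of '' S)) : ∀ a ∈ h.toWord, a.1 ∈ S := by
  induction hh using Subgroup.closure_induction with
  | mem x hx =>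
    obtain ⟨s, hs, rfl⟩ := hx
    simpa using hs
  | one => simp
  | mul x y _ _ hx hy =>
    intro a ha
    exact (List.mem_append.1 ((toWord_mul_sublist x y).subset ha)).elim (hx a) (hy a)
  | inv x _ hx =>
    intro a ha
    simp only [toWord_inv, invRev, List.mem_reverse, List.mem_map] at ha
    obtain ⟨b, hb, rfl⟩ := ha
    exact hx b hb

theorem IsReduced.append {L₁ L₂ : List (α × Bool)} (h₁ : IsReduced L₁) (h₂ : IsReduced L₂)
    (h : ∀ a ∈ L₁.getLast?, ∀ b ∈ L₂.head?, a.1 ≠ b.1) : IsReduced (L₁ ++ L₂) :=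
  List.isChain_append.2 ⟨h₁, h₂, fun a ha b hb hab => (h a ha b hb hab).elim⟩

theorem mk_mem_closure_image_of_of_mul_eq_mul (L : List (α × Bool)) (hL : IsReduced L)
    {h k : FreeGroup α} (hh : h ∈ Subgroup.closure (of '' S))
    (hk : k ∈ Subgroup.closure (of '' S)) (hne : h ≠ 1) (heq : mk L * h = k * mk L) :
    mk L ∈ Subgroup.closure (of '' S) := by
  classical
  rcases hLa : L with _ | ⟨a, M⟩
  · exact one_mem _
  by_cases ha : a.1 ∈ S
  · have hmk : mk (a :: M) = mk [a] * mk M := by simp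
    have haH := mk_singleton_mem_closure_image_of ha
    rw [hmk]
    refine mul_mem haH (mk_mem_closure_image_of_of_mul_eq_mul M
      (show IsReduced (a :: M) from hLa ▸ hL).tail hh
      (mul_mem (mul_mem (inv_mem haH) hk) haH) hne ?_)
    rw [hLa, hmk] at heq
    simp only [mul_assoc] at heq ⊢
    rw [← heq, inv_mul_cancel_left]
  rw [← hLa]
  rcases L.eq_nil_or_concat' with hLb | ⟨M', b, hLb⟩
  · simp [hLb] at hLa
  by_cases hb : b.1 ∈ S
  · have hmk : mk (M' ++ [b]) = mk M' * mk [b] := by simp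
    have hbH := mk_singleton_mem_closure_image_of hb
    rw [hLb, hmk]
    refine mul_mem (mk_mem_closure_image_of_of_mul_eq_mul M'
      (List.isChain_append.1 (hLb ▸ hL)).1
      (mul_mem (mul_mem hbH hh) (inv_mem hbH)) hk
      (fun hc => hne (conj_eq_one_iff.1 hc)) ?_) hbH
    rw [hLb, hmk] at heq
    rw [← mul_assoc, ← mul_assoc, heq]
    group
  have hS := fst_mem_of_mem_toWord_of_mem_closure hh
  have kS := fst_mem_of_mem_toWord_of_mem_closure hk
  have hLh : IsReduced (L ++ h.toWord) := hL.append isReduced_toWord fun x hx y hy hxy => by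
    simp only [hLb, List.getLast?_append, List.getLast?_singleton, Option.some_or,
      Option.mem_some_iff] at hx
    exact hb (hx ▸ hxy ▸ hS y (List.mem_of_mem_head? hy))
  have hkL : IsReduced (k.toWord ++ L) := isReduced_toWord.append hL fun x hx y hy hxy => by
    simp only [hLa, List.head?_cons, Option.mem_some_iff] at hy
    exact ha (hy ▸ hxy ▸ kS x (List.mem_of_mem_getLast? hx))
  have hwords : L ++ h.toWord = k.toWord ++ L := by
    rw [← hLh.reduce_eq, ← hkL.reduce_eq]
    apply reduce.sound
    simpa only [← mul_mk, mk_toWord] using heq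
  rcases hkw : k.toWord with _ | ⟨c, N⟩
  · rw [hkw, List.nil_append, List.append_right_eq_self, toWord_eq_nil_iff] at hwords
    exact (hne hwords).elim
  · rw [hkw, hLa] at hwords
    obtain ⟨rfl, -⟩ := List.cons.inj hwords
    exact (ha (kS a (by simp [hkw]))).elim
termination_by L.length
decreasing_by
  · simp [hLa]
  · simp [hLb]

theorem closure_image_of_inf_conjSub_eq_bot {g : FreeGroup α}
    (hg : g ∉ Subgroup.closure (of '' S)) :
    Subgroup.closure (of '' S) ⊓ conjSub g (Subgroup.closure (of '' S)) = ⊥ := by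
  classical
  refine (Subgroup.eq_bot_iff_forall _).2 ?_
  rintro h ⟨hh, k, hk, hkh⟩
  by_contra hne
  refine hg (mk_toWord (x := g) ▸ mk_mem_closure_image_of_of_mul_eq_mul g.toWord
    isReduced_toWord hh hk hne ?_)
  rw [mk_toWord, ← hkh]
  simp [mul_assoc]

end FreeGroup

theorem stmt13 :
    ∀ g : FreeGroup (Fin 4),
      g ∉ Subgroup.closure {FreeGroup.of (0 : Fin 4), FreeGroup.of 1, FreeGroup.of 2} →
      Subgroup.closure {FreeGroup.of (0 : Fin 4), FreeGroup.of 1, FreeGroup.of 2} ⊓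
        conjSub g (Subgroup.closure {FreeGroup.of (0 : Fin 4), FreeGroup.of 1, FreeGroup.of 2}) =
        ⊥ := by
  have hS : ({FreeGroup.of (0 : Fin 4), FreeGroup.of 1, FreeGroup.of 2} : Set (FreeGroup (Fin 4))) =
      FreeGroup.of '' {0, 1, 2} := by
    simp [Set.image_insert_eq]
  rw [hS]
  exact fun g hg => FreeGroup.closure_image_of_inf_conjSub_eq_bot hg
end

section
/- In the group G = F ⋊_φ ℤ/4 of Example 6.1, the subgroup H₁ (the image in G of the subgroup of F generated by x₀ and x₁) has weak width 3 in G: (a) there exist three elements g₁, g₂, g₃ of G lying in pairwise distinct double cosets of H₁ such that H₁ ∩ gᵢ⁻¹H₁gᵢ is infinite for each i ∈ {1,2,3}; and (b) for any four elements g₁, g₂, g₃, g₄ of G lying in pairwise distinct double cosets of H₁, at least one of the intersections H₁ ∩ gᵢ⁻¹H₁gᵢ is finite. -/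
noncomputable section

/-- The free group on basis `{x_i : i ∈ ℤ/4}`. -/
abbrev F : Type := FreeGroup (ZMod 4)

/-- The action of `ℤ/4` on `F` permuting the basis by `x_i ↦ x_{i+k}`. -/
def φ : Multiplicative (ZMod 4) →* MulAut F where
  toFun k := (FreeGroup.freeGroupCongr (Equiv.addRight (Multiplicative.toAdd k)) : F ≃* F)
  map_one' := by
    ext x
    simp
  map_mul' a b := by
    have h : (fun i : ZMod 4 => i + Multiplicative.toAdd (a * b)) =
        ((fun i : ZMod 4 => i + Multiplicative.toAdd a) ∘
          fun i : ZMod 4 => i + Multiplicative.toAdd b) := by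
      funext i
      show i + (Multiplicative.toAdd a + Multiplicative.toAdd b) =
        i + Multiplicative.toAdd b + Multiplicative.toAdd a
      abel
    ext x
    rw [MulAut.mul_apply]
    show FreeGroup.map _ x = FreeGroup.map _ (FreeGroup.map _ x)
    rw [FreeGroup.map.comp]
    exact congrArg (fun f => FreeGroup.map f x) h

/-- The group `G = F ⋊ ℤ/4` of Examples 6.1 and 6.2. -/
abbrev G : Type := F ⋊[φ] Multiplicative (ZMod 4)

/-- `a` lies in the double coset `H b H`. -/
def inDoubleCoset {G : Type*} [Group G] (H : Subgroup G) (a b : G) : Prop :=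
  ∃ h₁ ∈ H, ∃ h₂ ∈ H, a = h₁ * b * h₂

/-- The subgroup `H₁ = ⟨x₀, x₁⟩` of Example 6.1, viewed inside `G`. -/
def H₁ : Subgroup G :=
  Subgroup.map (SemidirectProduct.inl : F →* G)
    (Subgroup.closure {FreeGroup.of (0 : ZMod 4), FreeGroup.of 1})

namespace FreeGroup

variable {α : Type*} {S T : Set α}

theorem mk_mem_closure_of_forall_fst_mem {L : List (α × Bool)} (h : ∀ p ∈ L, p.1 ∈ S) :
    mk L ∈ Subgroup.closure (of '' S) := by
  induction L with
  | nil => exact one_mem _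
  | cons p L ih =>
    rw [← List.singleton_append, ← mul_mk]
    refine mul_mem ?_ (ih fun q hq => h q (List.mem_cons_of_mem _ hq))
    have hp : of p.1 ∈ Subgroup.closure (of '' S) :=
      Subgroup.subset_closure ⟨p.1, h p List.mem_cons_self, rfl⟩
    obtain ⟨i, _ | _⟩ := p
    · exact inv_mem hp
    · exact hp

variable [DecidableEq α]

theorem fst_mem_of_mem_toWord {x : FreeGroup α} (hx : x ∈ Subgroup.closure (of '' S)) :
    ∀ p ∈ x.toWord, p.1 ∈ S := by
  induction hx using Subgroup.closure_induction with
  | mem x hx => obtain ⟨i, hi, rfl⟩ := hx; simpa using hi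
  | one => simp
  | mul x y _ _ ihx ihy =>
    intro p hp
    rcases List.mem_append.1 ((toWord_mul_sublist x y).subset hp) with h | h
    · exact ihx p h
    · exact ihy p h
  | inv x _ ih =>
    intro p hp
    rw [toWord_inv] at hp
    simp only [invRev, List.mem_reverse, List.mem_map] at hp
    obtain ⟨q, hq, rfl⟩ := hp
    exact ih q hq

theorem eq_one_of_mem_closure_of_disjoint (hST : Disjoint S T) {x : FreeGroup α}
    (hS : x ∈ Subgroup.closure (of '' S)) (hT : x ∈ Subgroup.closure (of '' T)) : x = 1 := by
  rw [← toWord_eq_nil_iff, List.eq_nil_iff_forall_not_mem]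
  intro p hp
  exact Set.disjoint_left.1 hST (fst_mem_of_mem_toWord hS p hp) (fst_mem_of_mem_toWord hT p hp)

theorem toWord_conj_of_fst_notMem {L : List (α × Bool)} {p : α × Bool}
    (hL : IsReduced (L ++ [p])) (hp : p.1 ∉ S) {a : FreeGroup α}
    (ha : a ∈ Subgroup.closure (of '' S)) (ha1 : a ≠ 1) :
    (mk (L ++ [p]) * a * (mk (L ++ [p]))⁻¹).toWord =
      (L ++ [p]) ++ a.toWord ++ invRev (L ++ [p]) := by
  have hS := fst_mem_of_mem_toWord ha
  have hinv : IsReduced (invRev (L ++ [p])) := by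
    rw [isReduced_iff_reduce_eq, reduce_invRev, hL.reduce_eq]
  have hred : IsReduced ((L ++ [p]) ++ a.toWord ++ invRev (L ++ [p])) := by
    refine IsReduced.append_overlap ?_ ?_ (by simpa using ha1)
    · refine List.isChain_append.2 ⟨hL, isReduced_toWord, ?_⟩
      intro x hx y hy hxy
      simp only [List.getLast?_append, List.getLast?_singleton, Option.some_or,
        Option.mem_some_iff] at hx
      subst hx
      exact absurd (hxy ▸ hS y (List.mem_of_mem_head? hy)) hp
    · refine List.isChain_append.2 ⟨isReduced_toWord, hinv, ?_⟩
      intro x hx y hy hxy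
      simp only [invRev, List.map_append, List.map_cons, List.map_nil, List.reverse_append,
        List.reverse_cons, List.reverse_nil, List.nil_append, List.cons_append,
        List.head?_cons, Option.mem_some_iff] at hy
      subst hy
      exact absurd (hxy ▸ hS x (List.mem_of_mem_getLast? hx)) hp
  conv_lhs => rw [← mk_toWord (x := a), inv_mk, mul_mk, mul_mk, toWord_mk]
  exact hred.reduce_eq

theorem exists_mul_of_conj_mem_closure {f a : FreeGroup α}
    (ha : a ∈ Subgroup.closure (of '' S)) (ha1 : a ≠ 1)
    (hb : f * a * f⁻¹ ∈ Subgroup.closure (of '' T)) :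
    ∃ u ∈ Subgroup.closure (of '' T), ∃ v ∈ Subgroup.closure (of '' S), f = u * v := by
  suffices H : ∀ L : List (α × Bool), IsReduced L → ∀ a ∈ Subgroup.closure (of '' S), a ≠ 1 →
      mk L * a * (mk L)⁻¹ ∈ Subgroup.closure (of '' T) →
      ∃ u ∈ Subgroup.closure (of '' T), ∃ v ∈ Subgroup.closure (of '' S), mk L = u * v by
    rw [← mk_toWord (x := f)] at hb ⊢
    exact H _ isReduced_toWord a ha ha1 hb
  intro L
  induction L using List.reverseRecOn with
  | nil => exact fun _ _ _ _ _ => ⟨1, one_mem _, 1, one_mem _, rfl⟩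
  | append_singleton L p ih =>
    intro hL a ha ha1 hb
    by_cases hp : p.1 ∈ S
    · have hs : mk [p] ∈ Subgroup.closure (of '' S) :=
        mk_mem_closure_of_forall_fst_mem (by simpa using hp)
      obtain ⟨u, hu, v, hv, huv⟩ := ih (hL.infix (List.prefix_append L [p]).isInfix)
        (mk [p] * a * (mk [p])⁻¹) (mul_mem (mul_mem hs ha) (inv_mem hs))
        (mt conj_eq_one_iff.1 ha1) (by
          rw [← mul_mk] at hb
          convert hb using 1
          group)
      exact ⟨u, hu, v * mk [p], mul_mem hv hs, by rw [← mul_mk, huv, mul_assoc]⟩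
    · refine ⟨mk (L ++ [p]), mk_mem_closure_of_forall_fst_mem fun q hq => ?_, 1, one_mem _,
        (mul_one _).symm⟩
      refine fst_mem_of_mem_toWord hb q ?_
      rw [toWord_conj_of_fst_notMem hL hp ha ha1]
      exact List.mem_append_left _ (List.mem_append_left _ hq)

end FreeGroup

theorem φ_of (k : Multiplicative (ZMod 4)) (i : ZMod 4) :
    φ k (FreeGroup.of i) = FreeGroup.of (i + k.toAdd) := by
  simp [φ]

theorem inl_mem_H₁ {x : F} :
    (SemidirectProduct.inl x : G) ∈ H₁ ↔ x ∈ Subgroup.closure (FreeGroup.of '' {0, 1}) := by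
  rw [H₁, Set.image_pair]
  exact Subgroup.mem_map_iff_mem SemidirectProduct.inl_injective

theorem mem_H₁ {h : G} :
    h ∈ H₁ ↔ ∃ x ∈ Subgroup.closure (FreeGroup.of '' ({0, 1} : Set (ZMod 4))),
      SemidirectProduct.inl x = h := by
  rw [H₁, Set.image_pair]
  exact Subgroup.mem_map

theorem map_φ_closure (k : Multiplicative (ZMod 4)) (S : Set (ZMod 4)) :
    (Subgroup.closure (FreeGroup.of '' S)).map (φ k).toMonoidHom =
      Subgroup.closure (FreeGroup.of '' ((· + k.toAdd) '' S)) := by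
  rw [MonoidHom.map_closure, Set.image_image, Set.image_image]
  congr 1

theorem right_eq_of_inDoubleCoset {a b : G} (h : inDoubleCoset H₁ a b) : a.right = b.right := by
  obtain ⟨h₁, hh₁, h₂, hh₂, rfl⟩ := h
  obtain ⟨x, -, rfl⟩ := mem_H₁.1 hh₁
  obtain ⟨y, -, rfl⟩ := mem_H₁.1 hh₂
  simp

theorem inDoubleCoset_trans_symm {A : Type*} [Group A] {H : Subgroup A} {a b c : A}
    (ha : inDoubleCoset H a c) (hb : inDoubleCoset H b c) : inDoubleCoset H a b := by
  obtain ⟨p, hp, q, hq, rfl⟩ := ha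
  obtain ⟨r, hr, s, hs, rfl⟩ := hb
  exact ⟨p * r⁻¹, mul_mem hp (inv_mem hr), s⁻¹ * q, mul_mem (inv_mem hs) hq, by group⟩

theorem mem_conjSub {A : Type*} [Group A] {H : Subgroup A} {g x : A} :
    x ∈ conjSub g H ↔ g * x * g⁻¹ ∈ H := by
  rw [conjSub, Subgroup.mem_map]
  constructor
  · rintro ⟨y, hy, rfl⟩
    simpa [mul_assoc] using hy
  · intro h
    exact ⟨_, h, by simp [mul_assoc]⟩

theorem infinite_inf_conjSub_inr (k : Multiplicative (ZMod 4)) {i : ZMod 4}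
    (hi : i ∈ ({0, 1} : Set (ZMod 4))) (hik : i + k.toAdd ∈ ({0, 1} : Set (ZMod 4))) :
    Infinite ↥(H₁ ⊓ conjSub (SemidirectProduct.inr k) H₁) := by
  have hmem : (SemidirectProduct.inl (FreeGroup.of i) : G) ∈
      H₁ ⊓ conjSub (SemidirectProduct.inr k) H₁ := by
    refine ⟨inl_mem_H₁.2 (Subgroup.subset_closure ⟨i, hi, rfl⟩), mem_conjSub.2 ?_⟩
    rw [← map_inv, ← SemidirectProduct.inl_aut, φ_of]
    exact inl_mem_H₁.2 (Subgroup.subset_closure ⟨_, hik, rfl⟩)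
  refine Infinite.of_injective (fun n : ℕ => (⟨_, pow_mem hmem n⟩ : ↥(H₁ ⊓ conjSub _ H₁))) ?_
  intro m n hmn
  have h := congrArg (fun x : G => x.left.norm) (congrArg Subtype.val hmn)
  simpa [← map_pow, FreeGroup.norm_of_pow] using h

theorem disjoint_pair_image_add_two :
    Disjoint ((· + (2 : ZMod 4)) '' ({0, 1} : Set (ZMod 4))) {0, 1} := by
  rw [Set.image_pair, Set.disjoint_left]
  rintro x (rfl | rfl) <;> simp <;> decide

theorem inDoubleCoset_inr_of_infinite {g : G} (h : Infinite ↥(H₁ ⊓ conjSub g H₁)) :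
    g.right.toAdd ≠ 2 ∧ inDoubleCoset H₁ g (SemidirectProduct.inr g.right) := by
  obtain ⟨⟨x, hx, hxg⟩, hx1⟩ := exists_ne (1 : ↥(H₁ ⊓ conjSub g H₁))
  obtain ⟨a, ha, rfl⟩ := mem_H₁.1 hx
  have ha1 : φ g.right a ≠ 1 := by
    rw [Ne, EmbeddingLike.map_eq_one_iff]
    rintro rfl
    exact hx1 (Subtype.ext (map_one _))
  have haφ : φ g.right a ∈
      Subgroup.closure (FreeGroup.of '' ((· + g.right.toAdd) '' ({0, 1} : Set (ZMod 4)))) := by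
    rw [← map_φ_closure]
    exact Subgroup.mem_map_of_mem _ ha
  have hb : g.left * φ g.right a * g.left⁻¹ ∈
      Subgroup.closure (FreeGroup.of '' ({0, 1} : Set (ZMod 4))) := by
    have hg := mem_conjSub.1 (SetLike.mem_coe.1 hxg)
    rw [← inl_mem_H₁]
    convert hg using 1
    conv_rhs => rw [← SemidirectProduct.inl_left_mul_inr_right g]
    rw [map_mul, map_mul, SemidirectProduct.inl_aut, map_inv, map_inv]
    group
  obtain ⟨u, hu, v, hv, huv⟩ := FreeGroup.exists_mul_of_conj_mem_closure haφ ha1 hb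
  constructor
  · intro h2
    have hva := mul_mem (mul_mem hv haφ) (inv_mem hv)
    have hvb : v * φ g.right a * v⁻¹ ∈
        Subgroup.closure (FreeGroup.of '' ({0, 1} : Set (ZMod 4))) := by
      convert mul_mem (mul_mem (inv_mem hu) hb) hu using 1
      rw [huv]
      group
    rw [h2] at hva
    exact ha1 (by simpa using
      FreeGroup.eq_one_of_mem_closure_of_disjoint disjoint_pair_image_add_two hva hvb)
  · rw [← map_φ_closure] at hv
    obtain ⟨w, hw, rfl⟩ := hv
    refine ⟨_, inl_mem_H₁.2 hu, _, inl_mem_H₁.2 hw, ?_⟩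
    conv_lhs => rw [← SemidirectProduct.inl_left_mul_inr_right g, huv, map_mul]
    have := SemidirectProduct.inl_aut (φ := φ) g.right w
    simp only [MulEquiv.toMonoidHom_eq_coe, MonoidHom.coe_coe, this, map_inv]
    group

theorem stmt14 :
    (∃ g : Fin 3 → G,
      (∀ i j, i ≠ j → ¬ inDoubleCoset H₁ (g i) (g j)) ∧
      ∀ i, Infinite ↥(H₁ ⊓ conjSub (g i) H₁)) ∧
    (∀ g : Fin 4 → G,
      (∀ i j, i ≠ j → ¬ inDoubleCoset H₁ (g i) (g j)) →
      ∃ i, Finite ↥(H₁ ⊓ conjSub (g i) H₁)) := by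
  constructor
  · refine ⟨fun i => SemidirectProduct.inr (Multiplicative.ofAdd (![0, 1, 3] i)), ?_, ?_⟩
    · intro i j hij h
      have h' : (![0, 1, 3] : Fin 3 → ZMod 4) i = ![0, 1, 3] j :=
        Multiplicative.ofAdd.injective (right_eq_of_inDoubleCoset h)
      exact hij ((by decide : Function.Injective (![0, 1, 3] : Fin 3 → ZMod 4)) h')
    · intro i
      fin_cases i
      · exact infinite_inf_conjSub_inr (i := 0) _ (by simp) (by simp)
      · exact infinite_inf_conjSub_inr (i := 0) _ (by simp) (by simp)
      · exact infinite_inf_conjSub_inr (i := 1) _ (by simp) (Or.inl (by decide))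
  · intro g hg
    by_contra! hinf
    have key := fun i => inDoubleCoset_inr_of_infinite (hinf i)
    have hinj : Function.Injective fun i => (g i).right.toAdd := by
      intro i j hij
      by_contra hne
      have hr : (g i).right = (g j).right := Multiplicative.toAdd.injective hij
      exact hg i j hne (inDoubleCoset_trans_symm (hr ▸ (key i).2) (key j).2)
    have hsurj : Function.Surjective fun i => (g i).right.toAdd :=
      (Fintype.bijective_iff_injective_and_card _).2 ⟨hinj, rfl⟩ |>.2
    obtain ⟨i, hi⟩ := hsurj 2
    exact (key i).1 hi
end
end

section
/- In the group G = F ⋊_φ ℤ/4 of Example 6.2, the subgroup L₁ (the image in G of the subgroup of F generated by x₀, x₁ and x₂) has width 4 in G: (a) there exist four elements g₁, g₂, g₃, g₄ of G lying in pairwise distinct cosets of L₁ such that every pairwise intersection gᵢ⁻¹L₁gᵢ ∩ gⱼ⁻¹L₁gⱼ (i ≠ j) is infinite; and (b) for any five elements g₁,…,g₅ of G lying in pairwise distinct cosets of L₁, there exist indices i ≠ j such that the intersection gᵢ⁻¹L₁gᵢ ∩ gⱼ⁻¹L₁gⱼ is finite. -/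
noncomputable section

/-- The subgroup `L₁ = ⟨x₀, x₁, x₂⟩` of Example 6.2, viewed inside `G`. -/
def L₁ : Subgroup G :=
  Subgroup.map (SemidirectProduct.inl : F →* G)
    (Subgroup.closure {FreeGroup.of (0 : ZMod 4), FreeGroup.of 1, FreeGroup.of 2})

theorem isCyclic_of_isFreeGroup_of_isMulCommutative (K : Type*) [Group K] [IsFreeGroup K]
    (hcomm : ∀ a b : K, a * b = b * a) : IsCyclic K := by
  classical
  have hsub : Subsingleton (IsFreeGroup.Generators K) := by
    refine ⟨fun a b => by_contra fun hab => ?_⟩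
    let f : K →* Equiv.Perm (Fin 3) := IsFreeGroup.lift fun c =>
      if c = a then Equiv.swap 0 1 else Equiv.swap 1 2
    have h := congrArg f (hcomm (IsFreeGroup.of a) (IsFreeGroup.of b))
    simp only [f, map_mul, IsFreeGroup.lift_of, if_true, if_neg (Ne.symm hab)] at h
    exact absurd h (by decide)
  refine (IsFreeGroup.mulEquiv K).isCyclic.mp ?_
  rcases isEmpty_or_nonempty (IsFreeGroup.Generators K) with h | ⟨⟨a⟩⟩
  · infer_instance
  · refine ⟨FreeGroup.of a, fun x => ?_⟩
    induction x using FreeGroup.induction_on with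
    | C1 => exact (Subgroup.zpowers (FreeGroup.of a)).one_mem
    | of b => rw [Subsingleton.elim b a]; exact Subgroup.mem_zpowers _
    | inv_of b hb => exact (Subgroup.zpowers (FreeGroup.of a)).inv_mem hb
    | mul x y hx hy => exact (Subgroup.zpowers (FreeGroup.of a)).mul_mem hx hy

theorem FreeGroup.exists_zpow_eq_of_commute {α : Type*} {u v : FreeGroup α} (h : Commute u v) :
    ∃ (c : FreeGroup α) (m n : ℤ), c ^ m = u ∧ c ^ n = v := by
  have hcomm : IsMulCommutative (Subgroup.closure {u, v}) := by
    refine Subgroup.isMulCommutative_closure ?_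
    rintro x (rfl | rfl) y (rfl | rfl)
    exacts [rfl, h, h.symm, rfl]
  have hcyc := isCyclic_of_isFreeGroup_of_isMulCommutative (Subgroup.closure {u, v})
    fun a b => hcomm.is_comm.comm a b
  obtain ⟨c, hc⟩ := hcyc.exists_generator
  obtain ⟨m, hm⟩ := hc ⟨u, Subgroup.subset_closure (by simp)⟩
  obtain ⟨n, hn⟩ := hc ⟨v, Subgroup.subset_closure (by simp)⟩
  exact ⟨c, m, n, by simpa using congrArg Subtype.val hm, by simpa using congrArg Subtype.val hn⟩

/-- A retract `H` of a free group is malnormal up to the kernel of the retraction: any element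
conjugating a nontrivial element of `H` into `H` lies in `H`. -/
theorem FreeGroup.mem_of_conj_mem_of_retraction {α : Type*} {H : Subgroup (FreeGroup α)}
    (r : FreeGroup α →* FreeGroup α) (hrH : ∀ x, r x ∈ H) (hr : ∀ x ∈ H, r x = x)
    {u w : FreeGroup α} (hu : u ∈ H) (hu1 : u ≠ 1) (hw : w * u * w⁻¹ ∈ H) : w ∈ H := by
  have hconj : r w * u * (r w)⁻¹ = w * u * w⁻¹ := by
    simpa [hr u hu] using hr _ hw
  have hcomm : Commute u ((r w)⁻¹ * w) := by
    have : u * ((r w)⁻¹ * w) = (r w)⁻¹ * (r w * u * (r w)⁻¹) * w := by group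
    rw [Commute, SemiconjBy, this, hconj]
    group
  obtain ⟨c, m, n, hm, hn⟩ := FreeGroup.exists_zpow_eq_of_commute hcomm
  have hun : u ^ n = 1 := by
    have h : u ^ n = ((r w)⁻¹ * w) ^ m := by
      rw [← hm, ← hn, ← zpow_mul, ← zpow_mul, mul_comm]
    have hv : r ((r w)⁻¹ * w) = 1 := by
      rw [r.map_mul, r.map_inv, hr _ (hrH w), inv_mul_cancel]
    simpa only [map_zpow, hr u hu, hv, one_zpow] using congrArg r h
  have hn0 : n = 0 := by
    by_contra hn0
    exact hu1 ((IsMulTorsionFree.zpow_eq_one_iff_left hn0).mp hun)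
  rw [hn0, zpow_zero] at hn
  rw [← inv_mul_eq_one.mp hn.symm]
  exact hrH w

/-- Subgroups generated by part of a basis of a free group are malnormal. -/
theorem FreeGroup.mem_closure_of_image_of_conj_mem {α : Type*} (S : Set α) {u w : FreeGroup α}
    (hu : u ∈ Subgroup.closure (FreeGroup.of '' S)) (hu1 : u ≠ 1)
    (hw : w * u * w⁻¹ ∈ Subgroup.closure (FreeGroup.of '' S)) :
    w ∈ Subgroup.closure (FreeGroup.of '' S) := by
  classical
  let r : FreeGroup α →* FreeGroup α :=
    FreeGroup.lift fun a => if a ∈ S then FreeGroup.of a else 1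
  refine FreeGroup.mem_of_conj_mem_of_retraction r (fun x => ?_) (fun x hx => ?_) hu hu1 hw
  · induction x using FreeGroup.induction_on with
    | C1 => simp
    | of a =>
      by_cases ha : a ∈ S
      · simpa [r, ha] using Subgroup.subset_closure (Set.mem_image_of_mem FreeGroup.of ha)
      · simp [r, ha]
    | inv_of a ha => rw [r.map_inv]; exact inv_mem ha
    | mul x y hx hy => rw [r.map_mul]; exact mul_mem hx hy
  · have h : Set.EqOn r (MonoidHom.id _) (FreeGroup.of '' S) := by
      rintro _ ⟨a, ha, rfl⟩
      simp [r, ha]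
    exact MonoidHom.eqOn_closure h hx

theorem mem_conjSub_iff {Γ : Type*} [Group Γ] {H : Subgroup Γ} {g x : Γ} :
    x ∈ conjSub g H ↔ g * x * g⁻¹ ∈ H := by
  simp only [conjSub, Subgroup.mem_map]
  constructor
  · rintro ⟨y, hy, rfl⟩
    simpa [mul_assoc] using hy
  · intro h
    exact ⟨_, h, by simp [mul_assoc]⟩

theorem L₁_eq_map_closure_image : L₁ = Subgroup.map (SemidirectProduct.inl : F →* G)
    (Subgroup.closure (FreeGroup.of '' {0, 1, 2})) := by
  rw [L₁, Set.image_insert_eq, Set.image_pair]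

theorem right_eq_one_of_mem_L₁ {x : G} (hx : x ∈ L₁) : x.right = 1 := by
  obtain ⟨y, -, rfl⟩ := hx
  simp

theorem inl_of_mem_conjSub_inr {c k : ZMod 4} (h : c + k ∈ ({0, 1, 2} : Set (ZMod 4))) :
    (SemidirectProduct.inl (FreeGroup.of c) : G) ∈
      conjSub (SemidirectProduct.inr (Multiplicative.ofAdd k)) L₁ := by
  rw [mem_conjSub_iff, ← map_inv, ← SemidirectProduct.inl_aut, L₁_eq_map_closure_image]
  refine Subgroup.mem_map_of_mem _ (Subgroup.subset_closure ⟨c + k, h, ?_⟩)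
  simp [φ]

theorem infinite_conjSub_inr_inf_conjSub_inr (i j : ZMod 4) :
    Infinite ↥(conjSub (SemidirectProduct.inr (Multiplicative.ofAdd i) : G) L₁ ⊓
      conjSub (SemidirectProduct.inr (Multiplicative.ofAdd j)) L₁) := by
  have hc : ∃ c : ZMod 4, (c + i = 0 ∨ c + i = 1 ∨ c + i = 2) ∧
      (c + j = 0 ∨ c + j = 1 ∨ c + j = 2) := by
    revert i j
    decide
  obtain ⟨c, hci, hcj⟩ := hc
  have hmem : (SemidirectProduct.inl (FreeGroup.of c) : G) ∈
      conjSub (SemidirectProduct.inr (Multiplicative.ofAdd i) : G) L₁ ⊓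
        conjSub (SemidirectProduct.inr (Multiplicative.ofAdd j)) L₁ :=
    ⟨inl_of_mem_conjSub_inr hci, inl_of_mem_conjSub_inr hcj⟩
  refine Infinite.of_injective (fun n : ℕ => ⟨_, pow_mem hmem n⟩) fun m n hmn => ?_
  have h := congrArg Subtype.val hmn
  simp only [← map_pow] at h
  exact injective_pow_iff_not_isOfFinOrder.mpr
    (not_isOfFinOrder_of_isMulTorsionFree (FreeGroup.of_ne_one c)) (SemidirectProduct.inl_injective h)

theorem finite_conjSub_inf_conjSub {g h : G} (hright : g.right = h.right)
    (hgh : h * g⁻¹ ∉ L₁) : Finite ↥(conjSub g L₁ ⊓ conjSub h L₁) := by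
  suffices hbot : conjSub g L₁ ⊓ conjSub h L₁ = ⊥ by
    rw [hbot]
    infer_instance
  rw [eq_bot_iff]
  intro x hx
  obtain ⟨hxg, hxh⟩ := Subgroup.mem_inf.mp hx
  rw [mem_conjSub_iff, L₁_eq_map_closure_image] at hxg hxh
  obtain ⟨u, hu, hux⟩ := hxg
  obtain ⟨v, hv, hvx⟩ := hxh
  obtain ⟨w, hw⟩ : ∃ w : F, SemidirectProduct.inl w = h * g⁻¹ := by
    refine ⟨(h * g⁻¹).left, ?_⟩
    ext
    · simp
    · simp [hright]
  have hvw : v = w * u * w⁻¹ := by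
    apply SemidirectProduct.inl_injective (φ := φ)
    rw [map_mul, map_mul, map_inv, hvx, hux, hw]
    group
  by_cases hu1 : u = 1
  · rw [hu1, map_one] at hux
    exact conj_eq_one_iff.mp hux.symm
  · rw [← hw, L₁_eq_map_closure_image] at hgh
    exact absurd (Subgroup.mem_map_of_mem _
      (FreeGroup.mem_closure_of_image_of_conj_mem _ hu hu1 (hvw ▸ hv))) hgh

theorem stmt17 :
    (∃ g : Fin 4 → G,
      (∀ i j, i ≠ j → g j * (g i)⁻¹ ∉ L₁) ∧
      ∀ i j, i ≠ j → Infinite ↥(conjSub (g i) L₁ ⊓ conjSub (g j) L₁)) ∧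
    (∀ g : Fin 5 → G,
      (∀ i j, i ≠ j → g j * (g i)⁻¹ ∉ L₁) →
      ∃ i j, i ≠ j ∧ Finite ↥(conjSub (g i) L₁ ⊓ conjSub (g j) L₁)) := by
  constructor
  · refine ⟨fun k : ZMod 4 => SemidirectProduct.inr (Multiplicative.ofAdd k),
      fun i j hij hmem => hij ?_, fun i j _ => infinite_conjSub_inr_inf_conjSub_inr i j⟩
    have h := right_eq_one_of_mem_L₁ hmem
    rw [← map_inv, ← map_mul, SemidirectProduct.right_inr] at h
    exact (Multiplicative.ofAdd.injective (mul_inv_eq_one.mp h)).symm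
  · intro g hg
    obtain ⟨i, j, hij, hright⟩ := Fintype.exists_ne_map_eq_of_card_lt
      (fun i => Multiplicative.toAdd (g i).right) (by simp [ZMod.card])
    exact ⟨i, j, hij,
      finite_conjSub_inf_conjSub (Multiplicative.toAdd.injective hright) (hg i j hij)⟩
end
end
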